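/- Let c be a normalized Hochschild 2-cocycle with trivial coefficients on A_s(n,d). Then for all indices i ≠ j one has c(u_{ji}, u_{ji}) = −c(u_{ii}, u_{ji}). -/

import Mathlib

open scoped BigOperators

/-- The relations presenting the quantum permutation algebra `A_s(n,d)`. -/
inductive ASRel (n : ℕ) (d : Matrix (Fin n) (Fin n) ℂ) :
    FreeAlgebra ℂ (Fin n × Fin n) → FreeAlgebra ℂ (Fin n × Fin n) → Prop
  | row_orth (i j k : Fin n) :
      ASRel n d (FreeAlgebra.ι ℂ (i, j) * FreeAlgebra.ι ℂ (i, k))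
        (if j = k then FreeAlgebra.ι ℂ (i, j) else 0)
  | col_orth (i j k : Fin n) :
      ASRel n d (FreeAlgebra.ι ℂ (j, i) * FreeAlgebra.ι ℂ (k, i))
        (if j = k then FreeAlgebra.ι ℂ (j, i) else 0)
  | row_sum (i : Fin n) : ASRel n d (∑ j, FreeAlgebra.ι ℂ (i, j)) 1
  | col_sum (i : Fin n) : ASRel n d (∑ j, FreeAlgebra.ι ℂ (j, i)) 1
  | inter (i j : Fin n) :
      ASRel n d (∑ k, d i k • FreeAlgebra.ι ℂ (k, j)) (∑ k, d k j • FreeAlgebra.ι ℂ (i, k))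

/-- The quantum permutation algebra `A_s(n,d)`. -/
abbrev ASAlg (n : ℕ) (d : Matrix (Fin n) (Fin n) ℂ) := RingQuot (ASRel n d)

/-- The generators `u_{ij}` of `A_s(n,d)`. -/
noncomputable def ASu {n : ℕ} (d : Matrix (Fin n) (Fin n) ℂ) (i j : Fin n) : ASAlg n d :=
  RingQuot.mkAlgHom ℂ (ASRel n d) (FreeAlgebra.ι ℂ (i, j))

/-- The counit `ε : A_s(n,d) → ℂ`, the unique algebra map with `ε(u_{ij}) = δ_{ij}`. -/
noncomputable def ASeps (n : ℕ) (d : Matrix (Fin n) (Fin n) ℂ) : ASAlg n d →ₐ[ℂ] ℂ :=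
  RingQuot.liftAlgHom ℂ
    ⟨FreeAlgebra.lift ℂ (fun p => if p.1 = p.2 then (1 : ℂ) else 0), by
      intro a b h
      induction h with
      | row_orth i j k =>
          simp only [map_mul, FreeAlgebra.lift_ι_apply, apply_ite, map_zero]
          split_ifs <;> simp_all
      | col_orth i j k =>
          simp only [map_mul, FreeAlgebra.lift_ι_apply, apply_ite, map_zero]
          split_ifs <;> simp_all
      | row_sum i =>
          simp [FreeAlgebra.lift_ι_apply]
      | col_sum i =>
          simp [FreeAlgebra.lift_ι_apply]
      | inter i j =>
          simp [FreeAlgebra.lift_ι_apply, smul_ite]⟩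

lemma ASeps_u {n : ℕ} (d : Matrix (Fin n) (Fin n) ℂ) (i j : Fin n) :
    ASeps n d (ASu d i j) = if i = j then 1 else 0 := by
  simp [ASeps, ASu, RingQuot.liftAlgHom_mkAlgHom_apply, FreeAlgebra.lift_ι_apply]

lemma ASu_col_orth {n : ℕ} (d : Matrix (Fin n) (Fin n) ℂ) (i j k : Fin n) :
    ASu d j i * ASu d k i = if j = k then ASu d j i else 0 := by
  simpa [ASu, apply_ite] using RingQuot.mkAlgHom_rel ℂ (ASRel.col_orth (d := d) i j k)

lemma ASu_col_sum {n : ℕ} (d : Matrix (Fin n) (Fin n) ℂ) (i : Fin n) :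
    ∑ j, ASu d j i = 1 := by
  simpa [ASu] using RingQuot.mkAlgHom_rel ℂ (ASRel.col_sum (d := d) i)

/-- Item (7) of Lemma 5.2: for a normalized Hochschild 2-cocycle `c` with
trivial coefficients on `A_s(n,d)` and `i ≠ j`, `c(u_{ji}, u_{ji}) = −c(u_{ii}, u_{ji})`. -/
theorem cocycle_offdiag_square (n : ℕ) (hn : 1 ≤ n) (d : Matrix (Fin n) (Fin n) ℂ)
    (c : ASAlg n d →ₗ[ℂ] ASAlg n d →ₗ[ℂ] ℂ)
    (hcocycle : ∀ a b x : ASAlg n d,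
      ASeps n d a * c b x - c (a * b) x + c a (b * x) - c a b * ASeps n d x = 0)
    (hnorm : c 1 1 = 0) :
    ∀ i j : Fin n, i ≠ j →
      c (ASu d j i) (ASu d j i) = -c (ASu d i i) (ASu d j i) := by
  intro i j hij
  have one_left : c 1 (ASu d j i) = 0 := by
    simpa [hnorm] using hcocycle 1 1 (ASu d j i)
  have off_diag : ∀ k, k ≠ i → k ≠ j → c (ASu d k i) (ASu d j i) = 0 := by
    intro k hki hkj
    simpa [ASeps_u, ASu_col_orth, hki, hkj, hij.symm] using
      hcocycle (ASu d k i) (ASu d k i) (ASu d j i)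
  rw [← ASu_col_sum d i, map_sum, LinearMap.sum_apply,
    Finset.sum_eq_add i j hij (fun k _ hk => off_diag k hk.1 hk.2) (by simp) (by simp)] at one_left
  exact eq_neg_of_add_eq_zero_right one_left
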